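/- arXiv:math/0503528 — 2 statements merged into one kernel-verified Lean document; each statement's English description precedes it below -/
import Mathlib

section
/- Let I ⊆ ℂ[x₀,x₁,x₂,x₃] be a homogeneous prime ideal such that: I is generated as an ideal by its elements of degree at most 2; the Krull dimension of the quotient ring ℂ[x₀,x₁,x₂,x₃]/I equals 2; and for all x ∈ Z(I) and all f, g ∈ I the Poisson bracket vanishes at x, i.e. [f,g](x) = 0 (so the corresponding projective curve is legendrian). Then there exists an invertible linear map ψ ∈ GL₄(ℂ) such that ψ(Z(I)) is either a 2-dimensional linear subspace of ℂ⁴ or equals the affine cone over the twisted cubic, {(λ³, λ²μ, λμ², μ³) : λ, μ ∈ ℂ}. (Every irreducible legendrian curve in ℙ³ generated by polynomials of degree at most 2 is a line or a twisted cubic.) -/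
open MvPolynomial

/-- The Poisson bracket on `ℂ[x₀,x₁,x₂,x₃]` for the standard symplectic form on `ℂ⁴`:
`[f,g] = ∂₀f·∂₂g − ∂₂f·∂₀g + ∂₁f·∂₃g − ∂₃f·∂₁g`. -/
noncomputable def poissonBracket4 (f g : MvPolynomial (Fin 4) ℂ) : MvPolynomial (Fin 4) ℂ :=
  pderiv 0 f * pderiv 2 g - pderiv 2 f * pderiv 0 g +
    pderiv 1 f * pderiv 3 g - pderiv 3 f * pderiv 1 g

lemma aux_krull {A B : Type*} [CommRing A] [CommRing B] [Algebra A B] [Algebra.IsIntegral A B]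
    (hinj : Function.Injective (algebraMap A B)) : ringKrullDim A ≤ ringKrullDim B := by
  have := (faithfulSMul_iff_algebraMap_injective A B).2 hinj
  have key : ∀ l : LTSeries (PrimeSpectrum A), ∃ L : LTSeries (PrimeSpectrum B),
      L.length = l.length ∧ PrimeSpectrum.comap (algebraMap A B) L.last = l.last := by
    intro l
    induction l using RelSeries.inductionOn' with
    | singleton q =>
      obtain ⟨Q, hQ⟩ := Algebra.IsIntegral.comap_surjective A B q
      exact ⟨RelSeries.singleton _ Q, rfl, by simpa using hQ⟩
    | snoc l q hq ih =>
      obtain ⟨L, hL, hlast⟩ := ih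
      have hq' : l.last < q := hq
      have : (L.last.asIdeal.comap (algebraMap A B)) ≤ q.asIdeal := by
        have h2 : (PrimeSpectrum.comap (algebraMap A B) L.last).asIdeal ≤ q.asIdeal := by
          rw [hlast]; exact hq'.le
        exact h2
      obtain ⟨Q, hQ1, hQ2, hQ3⟩ := Ideal.exists_ideal_over_prime_of_isIntegral q.asIdeal
        L.last.asIdeal this
      have e : PrimeSpectrum.comap (algebraMap A B) ⟨Q, hQ2⟩ = q := by
        ext1; exact hQ3
      have hlt : L.last < ⟨Q, hQ2⟩ := by
        refine lt_of_le_of_ne hQ1 ?_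
        intro h
        rw [h, e] at hlast
        exact hq'.ne hlast.symm
      refine ⟨L.snoc ⟨Q, hQ2⟩ hlt, by simp [hL], by simpa using e⟩
  refine iSup_le fun l => ?_
  obtain ⟨L, hL, -⟩ := key l
  rw [← hL]
  exact Order.LTSeries.length_le_krullDim L

lemma aux_der {A B : Type*} [CommRing A] [CommRing B] [IsDomain B] [Algebra A B] [CharZero A]
    [IsDomain A] (hinj : Function.Injective (algebraMap A B)) (D : Derivation A B B) (x : B)
    (hx : IsIntegral A x) : D x = 0 := by
  have key : ∀ n : ℕ, ∀ P : Polynomial A, P.natDegree ≤ n → P ≠ 0 → Polynomial.aeval x P = 0 →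
      D x = 0 := by
    intro n
    induction n with
    | zero =>
      intro P hP hP0 h
      rw [Polynomial.eq_C_of_natDegree_le_zero hP] at h hP0
      rw [Polynomial.aeval_C] at h
      rw [(map_eq_zero_iff _ hinj).1 h] at hP0
      simp at hP0
    | succ n ih =>
      intro P hP hP0 h
      have h1 := D.map_aeval P x
      rw [h, map_zero] at h1
      rcases smul_eq_zero.1 h1.symm with h2 | h2
      · by_cases h3 : Polynomial.derivative P = 0
        · have := Polynomial.derivative_eq_zero.1 h3
          exact ih P (by omega) hP0 h
        · refine ih _ ?_ h3 h2
          have := Polynomial.natDegree_derivative_le P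
          omega
      · exact h2
  obtain ⟨P, hP, h⟩ := hx
  exact key _ P le_rfl hP.ne_zero h

lemma null {I : Ideal (MvPolynomial (Fin 4) ℂ)} (hI : I.IsPrime) {f : MvPolynomial (Fin 4) ℂ}
    (h : ∀ x : Fin 4 → ℂ, (∀ f ∈ I, eval x f = 0) → eval x f = 0) : f ∈ I := by
  rw [← MvPolynomial.IsPrime.vanishingIdeal_zeroLocus (K := ℂ) I]
  intro x hx
  exact h x (fun f hf => hx f hf)

lemma rank_lemma (I : Ideal (MvPolynomial (Fin 4) ℂ)) (hI : I.IsPrime)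
    (hdim : ringKrullDim (MvPolynomial (Fin 4) ℂ ⧸ I) = 2) :
    ∃ p : Fin 4 → ℂ, (∀ f ∈ I, eval p f = 0) ∧ ∀ w : Fin 4 → ℂ, ∃ f ∈ I,
      ¬ ∃ c : ℂ, ∀ i, eval p (pderiv i f) = c * w i := by
  by_contra hcon
  push Not at hcon
  have minors : ∀ f ∈ I, ∀ g ∈ I, ∀ i j,
      pderiv i f * pderiv j g - pderiv j f * pderiv i g ∈ I := by
    intro f hf g hg i j
    apply null hI
    intro x hx
    obtain ⟨w, hw⟩ := hcon x hx
    obtain ⟨c, hc⟩ := hw f hf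
    obtain ⟨d, hd⟩ := hw g hg
    simp only [map_sub, map_mul, hc, hd]
    ring
  obtain ⟨f0, hf0⟩ : ∃ f0 : MvPolynomial (Fin 4) ℂ, ∀ v : Fin 4 → MvPolynomial (Fin 4) ℂ,
      ∑ i, v i * pderiv i f0 ∈ I → ∀ g ∈ I, ∑ i, v i * pderiv i g ∈ I := by
    by_cases h : ∃ f ∈ I, ∃ i, pderiv i f ∉ I
    · obtain ⟨f, hf, i0, hi⟩ := h
      refine ⟨f, fun v hv g hg => ?_⟩
      have h1 : pderiv i0 f * ∑ i, v i * pderiv i g ∈ I := by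
        have : pderiv i0 f * ∑ i, v i * pderiv i g =
          (∑ i, v i * pderiv i f) * pderiv i0 g +
          ∑ i, v i * (pderiv i0 f * pderiv i g - pderiv i f * pderiv i0 g) := by
          rw [Finset.mul_sum, Finset.sum_mul, ← Finset.sum_add_distrib]
          exact Finset.sum_congr rfl fun i _ => by ring
        rw [this]
        exact I.add_mem (I.mul_mem_right _ hv)
          (I.sum_mem fun i _ => I.mul_mem_left _ (minors f hf g hg i0 i))
      exact (hI.mem_or_mem h1).resolve_left hi
    · push Not at h
      exact ⟨0, fun v _ g hg => I.sum_mem fun i _ => I.mul_mem_left _ (h g hg i)⟩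
  obtain ⟨s, -, g, ginj, gint⟩ := exists_integral_inj_algHom_of_quotient I hI.ne_top
  letI : Algebra (MvPolynomial (Fin s) ℂ) (MvPolynomial (Fin 4) ℂ ⧸ I) := g.toRingHom.toAlgebra
  letI : Module (MvPolynomial (Fin s) ℂ) (MvPolynomial (Fin 4) ℂ ⧸ I) := Algebra.toModule
  have hint : Algebra.IsIntegral (MvPolynomial (Fin s) ℂ) (MvPolynomial (Fin 4) ℂ ⧸ I) :=
    ⟨fun x => gint x⟩
  have hs : s ≤ 2 := by
    have := aux_krull (A := MvPolynomial (Fin s) ℂ) (B := MvPolynomial (Fin 4) ℂ ⧸ I) ginj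
    rw [hdim, MvPolynomial.ringKrullDim_of_isNoetherianRing, ringKrullDim_eq_zero_of_field] at this
    simp only [Nat.card_eq_fintype_card, Fintype.card_fin, zero_add] at this
    exact_mod_cast this
  choose T hT using fun j : Fin s => Ideal.Quotient.mk_surjective (I := I) (g (X j))
  let row : Fin 4 → MvPolynomial (Fin 4) ℂ := fun k =>
    if k = 0 then f0 else if h : k.val - 1 < s then T ⟨k.val - 1, h⟩ else 0
  let M : Matrix (Fin 4) (Fin 4) (MvPolynomial (Fin 4) ℂ ⧸ I) :=
    fun k i => Ideal.Quotient.mk I (pderiv i (row k))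
  have hM : M.det = 0 := by
    apply Matrix.det_eq_zero_of_row_eq_zero 3
    intro j
    have : row 3 = 0 := by
      simp only [row]
      rw [if_neg (by decide), dif_neg]
      have : ((3 : Fin 4) : ℕ) = 3 := rfl
      omega
    simp [M, this]
  obtain ⟨v, hv, hMv⟩ := Matrix.exists_mulVec_eq_zero_iff.2 hM
  choose u hu using fun i => Ideal.Quotient.mk_surjective (I := I) (v i)
  have hrow : ∀ k, ∑ i, u i * pderiv i (row k) ∈ I := by
    intro k
    rw [← Ideal.Quotient.eq_zero_iff_mem, map_sum]
    have := congrFun hMv k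
    simp only [Matrix.mulVec, dotProduct, M, Pi.zero_apply] at this
    rw [← this]
    exact Finset.sum_congr rfl fun i _ => by rw [map_mul, hu, mul_comm]
  let d : Derivation ℂ (MvPolynomial (Fin 4) ℂ) (MvPolynomial (Fin 4) ℂ) := ∑ i, u i • pderiv i
  have hd : ∀ f, d f = ∑ i, u i * pderiv i f := by
    intro f
    simp [d, Fin.sum_univ_four]
  have hdI : ∀ f, Ideal.Quotient.mkₐ ℂ I f = 0 → Ideal.Quotient.mkₐ ℂ I (d f) = 0 := by
    intro f hf
    rw [Ideal.Quotient.mkₐ_eq_mk, Ideal.Quotient.eq_zero_iff_mem] at hf ⊢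
    rw [hd]
    refine hf0 u ?_ f hf
    simpa [row] using hrow 0
  let D := Derivation.liftOfSurjective (Ideal.Quotient.mkₐ_surjective ℂ I) hdI
  have hD : ∀ f, D (Ideal.Quotient.mk I f) = Ideal.Quotient.mk I (d f) := fun f =>
    Derivation.liftOfSurjective_apply (Ideal.Quotient.mkₐ_surjective ℂ I) hdI f
  have hDX : ∀ j, D (g (X j)) = 0 := by
    intro j
    rw [← hT j, hD, Ideal.Quotient.eq_zero_iff_mem, hd]
    have := hrow ⟨j + 1, by omega⟩
    have e : row ⟨j + 1, by omega⟩ = T j := by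
      simp only [row]
      rw [if_neg (by simp [Fin.ext_iff]), dif_pos (by simp)]
      rfl
    rwa [e] at this
  have hDg : ∀ a, D (g a) = 0 := by
    intro a
    induction a using MvPolynomial.induction_on with
    | C c =>
      have : g (C c) = algebraMap ℂ _ c := g.commutes c
      rw [this, Derivation.map_algebraMap]
    | add p q hp hq => rw [map_add, map_add, hp, hq, add_zero]
    | mul_X p i hp => rw [map_mul, Derivation.leibniz, hp, hDX]; simp
  let D' : Derivation (MvPolynomial (Fin s) ℂ) (MvPolynomial (Fin 4) ℂ ⧸ I)
    (MvPolynomial (Fin 4) ℂ ⧸ I) :=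
    { toFun := D
      map_add' := fun x y => map_add D x y
      map_smul' := fun a x => by
        have : ∀ y, a • y = g a * y := fun y => rfl
        rw [this, Derivation.leibniz, hDg, RingHom.id_apply, this]; simp
      map_one_eq_zero' := Derivation.map_one_eq_zero D
      leibniz' := fun x y => D.leibniz x y }
  apply hv
  funext i
  have h1 := aux_der (A := MvPolynomial (Fin s) ℂ) ginj D' (Ideal.Quotient.mk I (X i)) (hint.1 _)
  have h2 : D (Ideal.Quotient.mk I (X i)) = 0 := h1
  rw [hD, hd] at h2
  rw [← hu, Pi.zero_apply, ← h2]
  congr 1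
  simp [pderiv_X, Pi.single_apply]

def om (u v : Fin 4 → ℂ) : ℂ := u 0 * v 2 - u 2 * v 0 + u 1 * v 3 - u 3 * v 1

def LV (Z : Set (Fin 4 → ℂ)) (a : Fin 4 → ℂ) : Prop := ∀ x ∈ Z, a ⬝ᵥ x = 0

def QV (Z : Set (Fin 4 → ℂ)) (S : Matrix (Fin 4) (Fin 4) ℂ) : Prop :=
  S.transpose = S ∧ ∀ x ∈ Z, x ⬝ᵥ S.mulVec x = 0

structure Hyp (Z : Set (Fin 4 → ℂ)) : Prop where
  irr1 : ∀ a b : Fin 4 → ℂ, (∀ x ∈ Z, (a ⬝ᵥ x) * (b ⬝ᵥ x) = 0) → LV Z a ∨ LV Z b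
  irr2 : ∀ (a : Fin 4 → ℂ) (S : Matrix (Fin 4) (Fin 4) ℂ), S.transpose = S →
    (∀ x ∈ Z, (a ⬝ᵥ x) * (x ⬝ᵥ S.mulVec x) = 0) → LV Z a ∨ QV Z S
  ll : ∀ a b : Fin 4 → ℂ, LV Z a → LV Z b → om a b = 0
  lq : ∀ (a : Fin 4 → ℂ) (S : Matrix (Fin 4) (Fin 4) ℂ), LV Z a → QV Z S →
    ∀ x ∈ Z, om a (S.mulVec x) = 0
  qq : ∀ (S T : Matrix (Fin 4) (Fin 4) ℂ), QV Z S → QV Z T →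
    ∀ x ∈ Z, om (S.mulVec x) (T.mulVec x) = 0
  gen : ∀ x, (∀ a, LV Z a → a ⬝ᵥ x = 0) → (∀ S, QV Z S → x ⬝ᵥ S.mulVec x = 0) → x ∈ Z
  rank : ∃ p ∈ Z, ∀ w : Fin 4 → ℂ, (∃ a, LV Z a ∧ ¬ ∃ c : ℂ, a = c • w) ∨
    (∃ S, QV Z S ∧ ¬ ∃ c : ℂ, S.mulVec p = c • w)

def Concl (Z : Set (Fin 4 → ℂ)) : Prop :=
  ∃ ψ : (Fin 4 → ℂ) ≃ₗ[ℂ] (Fin 4 → ℂ),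
      (∃ W : Submodule ℂ (Fin 4 → ℂ), Module.finrank ℂ W = 2 ∧
        ψ '' Z = (W : Set (Fin 4 → ℂ))) ∨
      ψ '' Z =
        {v : Fin 4 → ℂ | ∃ l m : ℂ, v = ![l ^ 3, l ^ 2 * m, l * m ^ 2, m ^ 3]}

def Symp (M : Matrix (Fin 4) (Fin 4) ℂ) : Prop :=
  ∀ a b, om (M.transpose.mulVec a) (M.transpose.mulVec b) = om a b

lemma om_nondeg {a : Fin 4 → ℂ} (h : ∀ b, om a b = 0) : a = 0 := by
  have h0 := h (Pi.single 0 1)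
  have h1 := h (Pi.single 1 1)
  have h2 := h (Pi.single 2 1)
  have h3 := h (Pi.single 3 1)
  simp [om] at h0 h1 h2 h3
  ext i
  fin_cases i <;> simp [h0, h1, h2, h3]

lemma Symp.inv {M : Matrix (Fin 4) (Fin 4) ℂ} (h : Symp M) :
    ∃ N : Matrix (Fin 4) (Fin 4) ℂ, M * N = 1 ∧ N * M = 1 := by
  have hu : IsUnit M.transpose := by
    rw [← Matrix.mulVec_injective_iff_isUnit]
    intro a b hab
    rw [← sub_eq_zero]
    apply om_nondeg
    intro c
    rw [← h, Matrix.mulVec_sub, hab, sub_self]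
    simp [om]
  rw [Matrix.isUnit_transpose] at hu
  obtain ⟨u, rfl⟩ := hu
  exact ⟨↑u⁻¹, u.mul_inv, u.inv_mul⟩

lemma dot_tr (M : Matrix (Fin 4) (Fin 4) ℂ) (a x : Fin 4 → ℂ) :
    a ⬝ᵥ M.mulVec x = M.transpose.mulVec a ⬝ᵥ x := by
  rw [Matrix.dotProduct_mulVec, Matrix.mulVec_transpose]

lemma quad_tr (M S : Matrix (Fin 4) (Fin 4) ℂ) (x : Fin 4 → ℂ) :
    M.mulVec x ⬝ᵥ S.mulVec (M.mulVec x) = x ⬝ᵥ (M.transpose * S * M).mulVec x := by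
  rw [dotProduct_comm, dot_tr, dotProduct_comm]
  simp only [Matrix.mulVec_mulVec, Matrix.mul_assoc]

lemma LV_tr {Z : Set (Fin 4 → ℂ)} (M : Matrix (Fin 4) (Fin 4) ℂ) (a : Fin 4 → ℂ) :
    LV (M.mulVec '' Z) a ↔ LV Z (M.transpose.mulVec a) := by
  simp only [LV, Set.forall_mem_image, dot_tr]

lemma sym_tr {M N S : Matrix (Fin 4) (Fin 4) ℂ} (h1 : M * N = 1) :
    (M.transpose * S * M).transpose = M.transpose * S * M ↔ S.transpose = S := by
  constructor
  · intro h
    have h2 : N.transpose * M.transpose = 1 := by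
      rw [← Matrix.transpose_mul, h1, Matrix.transpose_one]
    have e : ∀ T : Matrix (Fin 4) (Fin 4) ℂ,
        N.transpose * (M.transpose * T * M) * N = T := by
      intro T
      calc _ = (N.transpose * M.transpose) * T * (M * N) := by simp only [Matrix.mul_assoc]
        _ = T := by rw [h2, h1]; simp
    have h3 : M.transpose * S.transpose * M = M.transpose * S * M := by
      rw [← h]; simp [Matrix.mul_assoc]
    rw [← e S.transpose, h3, e]
  · intro h
    simp [Matrix.transpose_mul, h, Matrix.mul_assoc]

lemma QV_tr {Z : Set (Fin 4 → ℂ)} {M N : Matrix (Fin 4) (Fin 4) ℂ} (h1 : M * N = 1)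
    (S : Matrix (Fin 4) (Fin 4) ℂ) :
    QV (M.mulVec '' Z) S ↔ QV Z (M.transpose * S * M) := by
  simp only [QV, Set.forall_mem_image, quad_tr, sym_tr h1]

lemma Hyp.tr {Z : Set (Fin 4 → ℂ)} (H : Hyp Z) {M : Matrix (Fin 4) (Fin 4) ℂ} (hM : Symp M) :
    Hyp (M.mulVec '' Z) := by
  obtain ⟨N, h1, h2⟩ := hM.inv
  have h1' : N.transpose * M.transpose = 1 := by
    rw [← Matrix.transpose_mul, h1, Matrix.transpose_one]
  have h2' : M.transpose * N.transpose = 1 := by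
    rw [← Matrix.transpose_mul, h2, Matrix.transpose_one]
  have e : ∀ T : Matrix (Fin 4) (Fin 4) ℂ,
      M.transpose * (N.transpose * T * N) * M = T := by
    intro T
    calc _ = (M.transpose * N.transpose) * T * (N * M) := by simp only [Matrix.mul_assoc]
      _ = T := by rw [h2, h2']; simp
  have e' : ∀ a : Fin 4 → ℂ, M.transpose.mulVec (N.transpose.mulVec a) = a := by
    intro a; rw [Matrix.mulVec_mulVec, h2', Matrix.one_mulVec]
  have mv : ∀ S : Matrix (Fin 4) (Fin 4) ℂ, ∀ x, (M.transpose * S * M).mulVec x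
      = M.transpose.mulVec (S.mulVec (M.mulVec x)) := by
    intro S x
    simp only [Matrix.mulVec_mulVec, Matrix.mul_assoc]
  constructor
  · intro a b h
    simp only [Set.forall_mem_image, dot_tr] at h
    simpa only [LV_tr] using H.irr1 _ _ h
  · intro a S hS h
    simp only [Set.forall_mem_image, dot_tr M a, quad_tr] at h
    simpa only [LV_tr, QV_tr h1] using H.irr2 _ _ ((sym_tr h1).2 hS) h
  · intro a b ha hb
    rw [LV_tr] at ha hb
    rw [← hM]
    exact H.ll _ _ ha hb
  · intro a S ha hS
    rw [LV_tr] at ha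
    rw [QV_tr h1] at hS
    simp only [Set.forall_mem_image]
    intro x hx
    have := H.lq _ _ ha hS x hx
    rwa [mv, hM] at this
  · intro S T hS hT
    rw [QV_tr h1] at hS hT
    simp only [Set.forall_mem_image]
    intro x hx
    have := H.qq _ _ hS hT x hx
    rwa [mv, mv, hM] at this
  · intro y hl hq
    have hy : M.mulVec (N.mulVec y) = y := by
      rw [Matrix.mulVec_mulVec, h1, Matrix.one_mulVec]
    refine ⟨N.mulVec y, H.gen _ ?_ ?_, hy⟩
    · intro a ha
      rw [dot_tr]
      apply hl
      rwa [LV_tr, e']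
    · intro S hS
      rw [quad_tr]
      apply hq
      rwa [QV_tr h1, e]
  · obtain ⟨p, hp, hw⟩ := H.rank
    refine ⟨M.mulVec p, ⟨p, hp, rfl⟩, fun w => ?_⟩
    rcases hw (M.transpose.mulVec w) with ⟨a, ha, hn⟩ | ⟨S, hS, hn⟩
    · left
      refine ⟨N.transpose.mulVec a, by rwa [LV_tr, e'], ?_⟩
      rintro ⟨c, hc⟩
      apply hn
      refine ⟨c, ?_⟩
      rw [← e' a, hc, Matrix.mulVec_smul]
    · right
      refine ⟨N.transpose * S * N, by rwa [QV_tr h1, e], ?_⟩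
      rintro ⟨c, hc⟩
      apply hn
      refine ⟨c, ?_⟩
      rw [← e S, mv, hc, Matrix.mulVec_smul]

lemma Concl.tr {Z : Set (Fin 4 → ℂ)} {M : Matrix (Fin 4) (Fin 4) ℂ} (hM : Symp M)
    (h : Concl (M.mulVec '' Z)) : Concl Z := by
  obtain ⟨N, h1, h2⟩ := hM.inv
  obtain ⟨ψ, hψ⟩ := h
  refine ⟨(Matrix.toLin'OfInv h2 h1).trans ψ, ?_⟩
  have : ((Matrix.toLin'OfInv h2 h1).trans ψ) '' Z = ψ '' (M.mulVec '' Z) := by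
    rw [Set.image_image]
    rfl
  rw [this]
  exact hψ

/-- symplectic frame -/
lemma frame (y0 y1 : Fin 4 → ℂ) (hi : ∃ i j, y0 i * y1 j - y0 j * y1 i ≠ 0) (h : om y0 y1 = 0) :
    ∃ M : Matrix (Fin 4) (Fin 4) ℂ, Symp M ∧ M.transpose.mulVec (Pi.single 2 1) = y0 ∧
      M.transpose.mulVec (Pi.single 3 1) = y1 := by
  have ex : ∀ s t : ℂ, ∃ u : Fin 4 → ℂ, om u y0 = s ∧ om u y1 = t := by
    intro s t
    obtain ⟨i, j, hij⟩ := hi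
    have hne : i ≠ j := by rintro rfl; simp at hij
    let v : Fin 4 → ℂ := Pi.single i ((s * y1 j - t * y0 j) / (y0 i * y1 j - y0 j * y1 i)) +
      Pi.single j ((t * y0 i - s * y1 i) / (y0 i * y1 j - y0 j * y1 i))
    have hom : ∀ y, om ![v 2, v 3, - v 0, - v 1] y = v ⬝ᵥ y := by
      intro y
      simp [om, dotProduct, Fin.sum_univ_four]
      ring
    refine ⟨![v 2, v 3, - v 0, - v 1], ?_, ?_⟩
    · rw [hom]
      simp only [v, add_dotProduct, single_dotProduct]
      rw [div_mul_eq_mul_div, div_mul_eq_mul_div, ← add_div, div_eq_iff hij]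
      ring
    · rw [hom]
      simp only [v, add_dotProduct, single_dotProduct]
      rw [div_mul_eq_mul_div, div_mul_eq_mul_div, ← add_div, div_eq_iff hij]
      ring
  obtain ⟨x0, h00, h01⟩ := ex 1 0
  obtain ⟨x1, h10, h11⟩ := ex 0 1
  let x0' := x0 + om x0 x1 • y1
  have h00' : om x0' y0 = 1 := by
    simp only [om, x0', Pi.add_apply, Pi.smul_apply, smul_eq_mul] at *
    linear_combination h00 - (x0 0 * x1 2 - x0 2 * x1 0 + x0 1 * x1 3 - x0 3 * x1 1) * h
  have h01' : om x0' y1 = 0 := by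
    simp only [om, x0', Pi.add_apply, Pi.smul_apply, smul_eq_mul] at *
    linear_combination h01
  have hx' : om x0' x1 = 0 := by
    simp only [om, x0', Pi.add_apply, Pi.smul_apply, smul_eq_mul] at *
    linear_combination -(x0 0 * x1 2 - x0 2 * x1 0 + x0 1 * x1 3 - x0 3 * x1 1) * h11
  have key : ∀ a : Fin 4 → ℂ, (Matrix.of ![x0', x1, y0, y1]).transpose.mulVec a =
      a 0 • x0' + a 1 • x1 + a 2 • y0 + a 3 • y1 := by
    intro a
    ext i
    simp [Matrix.mulVec, dotProduct, Fin.sum_univ_four]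
    ring
  refine ⟨Matrix.of ![x0', x1, y0, y1], ?_, ?_, ?_⟩
  · intro a b
    rw [key, key]
    simp only [om, Pi.add_apply, Pi.smul_apply, smul_eq_mul] at *
    linear_combination (a 0 * b 1 - a 1 * b 0) * hx' + (a 0 * b 2 - a 2 * b 0) * h00' +
      (a 0 * b 3 - a 3 * b 0) * h01' + (a 1 * b 2 - a 2 * b 1) * h10 +
      (a 1 * b 3 - a 3 * b 1) * h11 + (a 2 * b 3 - a 3 * b 2) * h
  · rw [key]; simp
  · rw [key]; simp

lemma minor_of {y0 y1 : Fin 4 → ℂ} (h0 : y0 ≠ 0) (h : ¬ ∃ c : ℂ, y1 = c • y0) :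
    ∃ i j, y0 i * y1 j - y0 j * y1 i ≠ 0 := by
  by_contra hcon
  push Not at hcon
  obtain ⟨i, hi⟩ := Function.ne_iff.1 h0
  simp only [Pi.zero_apply] at hi
  apply h
  refine ⟨y1 i / y0 i, ?_⟩
  ext j
  have := hcon i j
  simp only [Pi.smul_apply, smul_eq_mul]
  field_simp
  linear_combination this

def qf (a b c d e f g h i j : ℂ) (x : Fin 4 → ℂ) : ℂ :=
  a * x 0 ^ 2 + b * (x 0 * x 1) + c * (x 0 * x 2) + d * (x 0 * x 3) + e * x 1 ^ 2 +
    f * (x 1 * x 2) + g * (x 1 * x 3) + h * x 2 ^ 2 + i * (x 2 * x 3) + j * x 3 ^ 2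

def G (Z : Set (Fin 4 → ℂ)) (a b c d e f g h i j : ℂ) : Prop :=
  ∀ x ∈ Z, qf a b c d e f g h i j x = 0

noncomputable def qm (a b c d e f g h i j : ℂ) : Matrix (Fin 4) (Fin 4) ℂ :=
  !![a, b / 2, c / 2, d / 2; b / 2, e, f / 2, g / 2; c / 2, f / 2, h, i / 2; d / 2, g / 2, i / 2, j]

lemma qm_sym (a b c d e f g h i j : ℂ) :
    (qm a b c d e f g h i j).transpose = qm a b c d e f g h i j := by
  ext k l
  fin_cases k <;> fin_cases l <;> rfl

lemma qm_eval (a b c d e f g h i j : ℂ) (x : Fin 4 → ℂ) :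
    x ⬝ᵥ (qm a b c d e f g h i j).mulVec x = qf a b c d e f g h i j x := by
  simp [qm, qf, Matrix.mulVec, dotProduct, Fin.sum_univ_four]
  ring

lemma QV_qm {Z : Set (Fin 4 → ℂ)} {a b c d e f g h i j : ℂ} :
    QV Z (qm a b c d e f g h i j) ↔ G Z a b c d e f g h i j := by
  simp only [QV, G, qm_sym, qm_eval, true_and]

lemma sym_eq {S : Matrix (Fin 4) (Fin 4) ℂ} (h : S.transpose = S) :
    S = qm (S 0 0) (2 * S 0 1) (2 * S 0 2) (2 * S 0 3) (S 1 1) (2 * S 1 2) (2 * S 1 3)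
      (S 2 2) (2 * S 2 3) (S 3 3) := by
  have e : ∀ i j, S i j = S j i := fun i j => congrFun (congrFun h.symm i) j
  ext k l
  fin_cases k <;> fin_cases l <;> simp [qm] <;> apply e

lemma G_br {Z : Set (Fin 4 → ℂ)} (H : Hyp Z) {a b c d e f g h i j : ℂ}
    {a' b' c' d' e' f' g' h' i' j' : ℂ}
    (h1 : G Z a b c d e f g h i j) (h2 : G Z a' b' c' d' e' f' g' h' i' j')
    (x : Fin 4 → ℂ) (hx : x ∈ Z) :
    (2 * a * x 0 + b * x 1 + c * x 2 + d * x 3) * (c' * x 0 + f' * x 1 + 2 * h' * x 2 + i' * x 3) -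
    (c * x 0 + f * x 1 + 2 * h * x 2 + i * x 3) * (2 * a' * x 0 + b' * x 1 + c' * x 2 + d' * x 3) +
    (b * x 0 + 2 * e * x 1 + f * x 2 + g * x 3) * (d' * x 0 + g' * x 1 + i' * x 2 + 2 * j' * x 3) -
    (d * x 0 + g * x 1 + i * x 2 + 2 * j * x 3) * (b' * x 0 + 2 * e' * x 1 + f' * x 2 + g' * x 3)
      = 0 := by
  have := H.qq _ _ (QV_qm.2 h1) (QV_qm.2 h2) x hx
  simp [om, qm, Matrix.mulVec, dotProduct, Fin.sum_univ_four] at this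
  linear_combination 4 * this

lemma irr2f {Z : Set (Fin 4 → ℂ)} (H : Hyp Z) (k : Fin 4) {a b c d e f g h i j : ℂ}
    (hh : ∀ x ∈ Z, x k * qf a b c d e f g h i j x = 0) :
    LV Z (Pi.single k 1) ∨ G Z a b c d e f g h i j := by
  rw [← QV_qm]
  apply H.irr2 _ _ (qm_sym ..)
  simpa [qm_eval] using hh

lemma binary {Z : Set (Fin 4 → ℂ)} (H : Hyp Z) (k l : Fin 4) {s t u : ℂ}
    (hh : ∀ x ∈ Z, s * x k ^ 2 + t * (x k * x l) + u * x l ^ 2 = 0) :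
    (s = 0 ∧ t = 0 ∧ u = 0) ∨ ∃ a b : ℂ, (a ≠ 0 ∨ b ≠ 0) ∧
      LV Z (Pi.single k a + Pi.single l b) := by
  have fac : ∃ a b c d : ℂ, a * c = s ∧ a * d + b * c = t ∧ b * d = u := by
    by_cases hs : s = 0
    · exact ⟨0, 1, t, u, by simp [hs], by simp, by simp⟩
    · obtain ⟨r, hr⟩ := IsAlgClosed.exists_pow_nat_eq (t ^ 2 - 4 * s * u) (n := 2) (by norm_num)
      refine ⟨1, (t - r) / (2 * s), s, (t + r) / 2, by simp, by field_simp; ring, ?_⟩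
      field_simp
      linear_combination -hr
  by_cases h0 : s = 0 ∧ t = 0 ∧ u = 0
  · exact Or.inl h0
  right
  obtain ⟨a, b, c, d, h1, h2, h3⟩ := fac
  have := H.irr1 (Pi.single k a + Pi.single l b) (Pi.single k c + Pi.single l d) (by
    intro x hx
    simp only [add_dotProduct, single_dotProduct]
    rw [← hh x hx, ← h1, ← h2, ← h3]
    ring)
  rcases this with h | h
  · refine ⟨a, b, ?_, h⟩
    by_contra hc
    push Not at hc
    apply h0
    rw [← h1, ← h2, ← h3, hc.1, hc.2]
    simp
  · refine ⟨c, d, ?_, h⟩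
    by_contra hc
    push Not at hc
    apply h0
    rw [← h1, ← h2, ← h3, hc.1, hc.2]
    simp

lemma caseA1 {Z : Set (Fin 4 → ℂ)} (H : Hyp Z) (h2 : LV Z (Pi.single 2 1))
    (h3 : LV Z (Pi.single 3 1)) : Concl Z := by
  have L01 : ∀ a, LV Z a → a 0 = 0 ∧ a 1 = 0 := by
    intro a ha
    have e2 := H.ll _ _ ha h2
    have e3 := H.ll _ _ ha h3
    simp [om] at e2 e3
    exact ⟨e2, e3⟩
  have z2 : ∀ x ∈ Z, x 2 = 0 := by simpa [LV] using h2
  have z3 : ∀ x ∈ Z, x 3 = 0 := by simpa [LV] using h3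
  have hZ : ∀ x, x ∈ Z ↔ x 2 = 0 ∧ x 3 = 0 := by
    intro x
    refine ⟨fun hx => ⟨z2 x hx, z3 x hx⟩, fun ⟨hx2, hx3⟩ => H.gen x ?_ ?_⟩
    · intro a ha
      obtain ⟨e0, e1⟩ := L01 a ha
      simp [dotProduct, Fin.sum_univ_four, *]
    · intro S hS
      have hS' := hS
      rw [sym_eq hS.1, QV_qm] at hS
      rcases binary H 0 1 (s := S 0 0) (t := 2 * S 0 1) (u := S 1 1) (by
        intro y hy
        have := hS y hy
        simp only [qf, z2 y hy, z3 y hy] at this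
        linear_combination this) with ⟨e1, e2, e3⟩ | ⟨a, b, hab, hl⟩
      · rw [sym_eq hS'.1, qm_eval]
        simp [qf, hx2, hx3, e1, e2, e3]
      · exfalso
        have := L01 _ hl
        simp at this
        rcases hab with h | h
        · exact h this.1
        · exact h this.2
  let f : (Fin 2 → ℂ) →ₗ[ℂ] (Fin 4 → ℂ) :=
    { toFun := fun v => ![v 0, v 1, 0, 0]
      map_add' := fun v w => by ext i; fin_cases i <;> simp
      map_smul' := fun c v => by ext i; fin_cases i <;> simp }
  have finj : Function.Injective f := by
    intro v w hvw
    have e0 : v 0 = w 0 := congrFun hvw 0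
    have e1 : v 1 = w 1 := congrFun hvw 1
    ext i; fin_cases i
    · exact e0
    · exact e1
  refine ⟨LinearEquiv.refl ℂ _, Or.inl ⟨LinearMap.range f, ?_, ?_⟩⟩
  · rw [LinearMap.finrank_range_of_inj finj]; simp
  · have hid : (LinearEquiv.refl ℂ (Fin 4 → ℂ)) '' Z = Z := by
      ext; simp
    rw [hid]
    ext x
    simp only [LinearEquiv.refl_apply, Set.image_id', SetLike.mem_coe, LinearMap.mem_range]
    rw [hZ]
    constructor
    · rintro ⟨hx2, hx3⟩
      refine ⟨![x 0, x 1], ?_⟩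
      ext i; fin_cases i <;> simp [f, hx2, hx3]
    · rintro ⟨v, rfl⟩
      simp [f]

lemma caseA2 {Z : Set (Fin 4 → ℂ)} (H : Hyp Z) (h2 : LV Z (Pi.single 2 1))
    (hL : ∀ a, LV Z a → ∃ c : ℂ, a = c • (Pi.single 2 1 : Fin 4 → ℂ)) : False := by
  have z2 : ∀ x ∈ Z, x 2 = 0 := by simpa [LV] using h2
  obtain ⟨p, hp, hr⟩ := H.rank
  rcases hr (Pi.single 2 1) with ⟨a, ha, hn⟩ | ⟨S, hS, hn⟩
  · exact hn (hL a ha)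
  · apply hn
    have hS' := hS
    rw [sym_eq hS.1, QV_qm] at hS
    have hd : LV Z ![2 * S 0 0, 2 * S 0 1, 0, 2 * S 0 3] := by
      intro x hx
      have := H.lq _ _ h2 hS' x hx
      rw [sym_eq hS'.1] at this
      simp [om, qm, Matrix.mulVec, dotProduct, Fin.sum_univ_four, z2 x hx] at this ⊢
      linear_combination -2 * this
    obtain ⟨c, hc⟩ := hL _ hd
    have e0 : S 0 0 = 0 := by simpa using congrFun hc 0
    have e1 : S 0 1 = 0 := by simpa using congrFun hc 1
    have e3 : S 0 3 = 0 := by simpa using congrFun hc 3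
    rcases binary H 1 3 (s := S 1 1) (t := 2 * S 1 3) (u := S 3 3) (by
        intro y hy
        have := hS y hy
        simp only [qf, z2 y hy, e0, e1, e3] at this
        linear_combination this) with ⟨f1, f2, f3⟩ | ⟨a, b, hab, hl⟩
    · refine ⟨S 0 2 * p 0 + S 1 2 * p 1 + S 2 3 * p 3, ?_⟩
      have f2' : S 1 3 = 0 := by simpa using f2
      rw [sym_eq hS'.1]
      ext i
      fin_cases i <;>
        simp [qm, Matrix.mulVec, dotProduct, Fin.sum_univ_four, e0, e1, e3, f1, f2', f3, z2 p hp]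
    · exfalso
      obtain ⟨c, hc⟩ := hL _ hl
      have g1 : a = 0 := by simpa using congrFun hc 1
      have g2 : b = 0 := by simpa using congrFun hc 3
      rcases hab with h | h
      · exact h g1
      · exact h g2

lemma stepB {Z : Set (Fin 4 → ℂ)} (H : Hyp Z) (L0 : ∀ a, LV Z a → a = 0)
    (he : (Pi.single 0 1 : Fin 4 → ℂ) ∈ Z)
    {α β γ a22 a23 a33 δ σ τ b22 b23 b33 : ℂ}
    (A : G Z 0 0 1 0 α β γ a22 a23 a33) (B : G Z 0 0 0 1 δ σ τ b22 b23 b33) :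
    (∀ a b c d e f g h i j, G Z a b c d e f g h i j → a = 0 ∧ b = 0) ∧ α = 0 ∧ δ ≠ 0 ∧
      γ = 1 / 3 ∧ (∀ e f g h i j, G Z 0 0 0 0 e f g h i j → e = 0 ∧ g = 0) := by
  have st1 : ∀ a b c d e f g h i j, G Z a b c d e f g h i j → a = 0 ∧ b = 0 := by
    intro a b c d e f g h i j hq
    have h1 := hq _ he
    have h2 := G_br H hq B _ he
    simp [qf] at h1 h2
    exact ⟨h1, h2⟩
  have hα : α = 0 := by
    have h1 : G Z 0 (2 * α) β (γ - 1) (2 * α * τ - 2 * γ * δ)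
        (σ + 2 * α * b23 + β * τ - γ * σ - 2 * δ * a23) (-β + 4 * α * b33 - 4 * δ * a33)
        (2 * b22 + β * b23 - a23 * σ)
        (b23 - 2 * a22 + 2 * β * b33 + γ * b23 - a23 * τ - 2 * a33 * σ)
        (-a23 + 2 * γ * b33 - 2 * a33 * τ) := by
      intro x hx
      have := G_br H A B x hx
      simp only [qf]
      linear_combination this
    simpa using (st1 _ _ _ _ _ _ _ _ _ _ h1).2
  subst hα
  have br3 : ∀ e f g h i j, G Z 0 0 0 0 e f g h i j →
      G Z 0 (-2 * e) (-f) (-g) (2 * δ * g - 2 * e * τ) (2 * δ * i + σ * g - τ * f - 2 * e * b23)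
        (f + 4 * δ * j - 4 * e * b33) (σ * i - b23 * f)
        (2 * h + 2 * σ * j + τ * i - b23 * g - 2 * b33 * f) (i + 2 * τ * j - 2 * b33 * g) := by
    intro e f g h i j hq x hx
    have := G_br H B hq x hx
    simp only [qf]
    linear_combination this
  have st3 : ∀ e f g h i j, G Z 0 0 0 0 e f g h i j → e = 0 := by
    intro e f g h i j hq
    simpa using (st1 _ _ _ _ _ _ _ _ _ _ (br3 _ _ _ _ _ _ hq)).2
  have hδ : δ ≠ 0 := by
    rintro rfl
    rcases irr2f H 2 (a := 1) (b := β + τ) (c := b23 + a22) (d := b33) (e := β * τ - γ * σ)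
      (f := β * b23 + a22 * τ - γ * b22 - a23 * σ) (g := β * b33 - a33 * σ)
      (h := a22 * b23 - a23 * b22) (i := a22 * b33 - a33 * b22) (j := 0) (by
        intro x hx
        have h1 := A x hx
        have h2 := B x hx
        simp only [qf] at h1 h2 ⊢
        linear_combination (x 0 + τ * x 1 + b23 * x 2 + b33 * x 3) * h1 -
          (γ * x 1 + a23 * x 2 + a33 * x 3) * h2) with h | h
    · have := congrFun (L0 _ h) 2
      simp at this
    · exact one_ne_zero (st1 _ _ _ _ _ _ _ _ _ _ h).1
  have hγ : γ = 1 / 3 := by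
    have h1 : G Z 0 0 0 0 (- 2 * γ * δ - (γ - 1) * δ)
        ((σ + β * τ - γ * σ - 2 * δ * a23) - β * β - (γ - 1) * σ)
        ((-β - 4 * δ * a33) - β * γ - (γ - 1) * τ)
        ((2 * b22 + β * b23 - a23 * σ) - β * a22 - (γ - 1) * b22)
        ((b23 - 2 * a22 + 2 * β * b33 + γ * b23 - a23 * τ - 2 * a33 * σ) - β * a23 - (γ - 1) * b23)
        ((-a23 + 2 * γ * b33 - 2 * a33 * τ) - β * a33 - (γ - 1) * b33) := by
      intro x hx
      have h0 := G_br H A B x hx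
      have h1 := A x hx
      have h2 := B x hx
      simp only [qf] at h1 h2 ⊢
      linear_combination h0 - β * h1 - (γ - 1) * h2
    have h2 := st3 _ _ _ _ _ _ h1
    have h3 : δ * (1 - 3 * γ) = 0 := by linear_combination h2
    rcases mul_eq_zero.1 h3 with h | h
    · exact absurd h hδ
    · linear_combination -h / 3
  refine ⟨st1, rfl, hδ, hγ, fun e f g h i j hq => ?_⟩
  have he0 := st3 _ _ _ _ _ _ hq
  refine ⟨he0, ?_⟩
  subst he0
  have h1 : G Z 0 0 0 0 (2 * δ * g + g * δ) ((2 * δ * i + σ * g - τ * f) + f * β + g * σ)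
        ((f + 4 * δ * j) + f * γ + g * τ) ((σ * i - b23 * f) + f * a22 + g * b22)
        ((2 * h + 2 * σ * j + τ * i - b23 * g - 2 * b33 * f) + f * a23 + g * b23)
        ((i + 2 * τ * j - 2 * b33 * g) + f * a33 + g * b33) := by
    intro x hx
    have h0 := G_br H B hq x hx
    have h1 := A x hx
    have h2 := B x hx
    simp only [qf] at h1 h2 ⊢
    linear_combination h0 + f * h1 + g * h2
  have h2 := st3 _ _ _ _ _ _ h1
  have h3 : δ * g = 0 := by linear_combination h2 / 3
  exact (mul_eq_zero.1 h3).resolve_left hδ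

lemma caseC {Z : Set (Fin 4 → ℂ)} (H : Hyp Z) (L0 : ∀ a, LV Z a → a = 0)
    (he : (Pi.single 0 1 : Fin 4 → ℂ) ∈ Z)
    {δ σ τ b22 b23 b33 : ℂ}
    (A : G Z 0 0 1 0 0 0 (1 / 3) 0 0 0) (B : G Z 0 0 0 1 δ σ τ b22 b23 b33) : Concl Z := by
  obtain ⟨st1, -, hδ, -, st3⟩ := stepB H L0 he A B
  have bin : ∀ h i j, G Z 0 0 0 0 0 0 0 h i j → h = 0 ∧ i = 0 ∧ j = 0 := by
    intro h i j hq
    rcases binary H 2 3 (s := h) (t := i) (u := j) (by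
      intro x hx
      have := hq x hx
      simp only [qf] at this
      linear_combination this) with h | ⟨a, b, hab, hl⟩
    · exact h
    · exfalso
      have h0 := L0 _ hl
      have g1 : a = 0 := by simpa using congrFun h0 2
      have g2 : b = 0 := by simpa using congrFun h0 3
      rcases hab with h | h
      · exact h g1
      · exact h g2
  have st4 : ∀ e f g h i j, G Z 0 0 0 0 e f g h i j → e = 0 ∧ g = 0 ∧ h = 0 ∧ i = 0 := by
    intro e f g h i j hq
    obtain ⟨rfl, rfl⟩ := st3 _ _ _ _ _ _ hq
    have h1 : G Z 0 0 0 0 0 0 0 (4 / 3 * h) (2 / 3 * i) 0 := by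
      intro x hx
      have h0 := G_br H A hq x hx
      have h1 := hq x hx
      simp only [qf] at h1 ⊢
      linear_combination h0 - 2 / 3 * h1
    obtain ⟨g1, g2, -⟩ := bin _ _ _ h1
    exact ⟨rfl, rfl, by simpa using g1, by simpa using g2⟩
  have hc : G Z 0 0 0 0 0 (4 / 3 * σ) (2 / 3 * τ) (8 / 3 * b22) (2 * b23) (4 / 3 * b33) := by
    intro x hx
    have h0 := G_br H A B x hx
    have h1 := B x hx
    simp only [qf] at h1 ⊢
    linear_combination h0 + 2 / 3 * h1
  obtain ⟨-, hτ, h22, h23⟩ := st4 _ _ _ _ _ _ hc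
  have hτ : τ = 0 := by simpa using hτ
  have h22 : b22 = 0 := by simpa using h22
  have h23 : b23 = 0 := by simpa using h23
  subst hτ h22 h23
  have B0 : G Z 0 0 0 1 δ 0 0 0 0 0 := by
    intro x hx
    have h0 := hc x hx
    have h1 := B x hx
    simp only [qf] at h0 h1 ⊢
    linear_combination h1 - 3 / 4 * h0
  have C0 : G Z 0 0 0 0 0 (-δ) 0 0 0 (1 / 3) := by
    rcases irr2f H 1 (a := 0) (b := 0) (c := 0) (d := 0) (e := 0) (f := -δ) (g := 0) (h := 0)
      (i := 0) (j := 1 / 3) (by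
        intro x hx
        have h1 := A x hx
        have h2 := B0 x hx
        simp only [qf] at h1 h2 ⊢
        linear_combination x 3 * h1 - x 2 * h2) with h | h
    · have := congrFun (L0 _ h) 1
      simp at this
    · exact h
  have hZ : ∀ x, x ∈ Z ↔ x 0 * x 2 + x 1 * x 3 / 3 = 0 ∧ x 0 * x 3 + δ * x 1 ^ 2 = 0 ∧
      x 3 ^ 2 = 3 * δ * x 1 * x 2 := by
    intro x
    constructor
    · intro hx
      have h1 := A x hx
      have h2 := B0 x hx
      have h3 := C0 x hx
      simp only [qf] at h1 h2 h3
      refine ⟨by linear_combination h1, by linear_combination h2, by linear_combination 3 * h3⟩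
    · rintro ⟨h1, h2, h3⟩
      apply H.gen
      · intro a ha
        rw [L0 a ha]; simp
      · intro S hS
        rw [sym_eq hS.1, qm_eval]
        rw [sym_eq hS.1, QV_qm] at hS
        generalize S 0 0 = a, 2 * S 0 1 = b, 2 * S 0 2 = c, 2 * S 0 3 = d, S 1 1 = e,
          2 * S 1 2 = f, 2 * S 1 3 = g, S 2 2 = h, 2 * S 2 3 = i, S 3 3 = j at hS ⊢
        obtain ⟨rfl, rfl⟩ := st1 _ _ _ _ _ _ _ _ _ _ hS
        have t1 : G Z 0 0 0 0 (e - d * δ) f (g - c / 3) h i j := by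
          intro y hy
          have k1 := A y hy
          have k2 := B0 y hy
          have k3 := hS y hy
          simp only [qf] at k1 k2 k3 ⊢
          linear_combination k3 - c * k1 - d * k2
        obtain ⟨u1, u2, rfl, rfl⟩ := st4 _ _ _ _ _ _ t1
        have t2 : G Z 0 0 0 0 0 0 0 0 0 (j + f / (3 * δ)) := by
          intro y hy
          have k1 := t1 y hy
          have k2 := C0 y hy
          simp only [qf] at k1 k2 ⊢
          rw [u1, u2] at k1
          have e1 : f / (3 * δ) = f / δ * (1 / 3) := by field_simp
          have e2 : f / δ * δ = f := by field_simp
          rw [e1]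
          linear_combination k1 + f / δ * k2 + (y 1 * y 2) * e2
        obtain ⟨-, -, u3⟩ := bin _ _ _ t2
        have u3' : 3 * δ * j = - f := by
          field_simp at u3
          linear_combination u3
        have : δ * qf 0 0 c d e f g 0 0 j x = 0 := by
          simp only [qf]
          linear_combination δ * c * h1 + δ * d * h2 + δ * x 1 ^ 2 * u1 + δ * x 1 * x 3 * u2 +
            x 3 ^ 2 / 3 * u3' - f / 3 * h3
        exact (mul_eq_zero.1 this).resolve_left hδ
  let ψ : (Fin 4 → ℂ) ≃ₗ[ℂ] (Fin 4 → ℂ) :=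
    { toFun := fun x => ![-9 * δ * x 0, 3 * δ * x 1, x 3, x 2]
      invFun := fun y => ![-(y 0) / (9 * δ), y 1 / (3 * δ), y 3, y 2]
      map_add' := fun v w => by ext i; fin_cases i <;> simp <;> ring
      map_smul' := fun c v => by ext i; fin_cases i <;> simp <;> ring
      left_inv := fun x => by
        ext i; fin_cases i <;> simp <;> field_simp
      right_inv := fun x => by
        ext i; fin_cases i <;> simp <;> field_simp }
  have ψa : ∀ x, ψ x = ![-9 * δ * x 0, 3 * δ * x 1, x 3, x 2] := fun x => rfl
  refine ⟨ψ, Or.inr ?_⟩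
  ext v
  simp only [Set.mem_image, Set.mem_setOf_eq]
  constructor
  · rintro ⟨x, hx, rfl⟩
    obtain ⟨h1, h2, h3⟩ := (hZ x).1 hx
    rw [ψa]
    by_cases hx2 : x 2 = 0
    · have hx3 : x 3 = 0 := by simpa [hx2] using h3
      have hx1 : x 1 = 0 := by simpa [hx3, hδ] using h2
      obtain ⟨l, hl⟩ := IsAlgClosed.exists_pow_nat_eq (-9 * δ * x 0) (n := 3) (by norm_num)
      refine ⟨l, 0, ?_⟩
      ext i; fin_cases i <;> simp [hl, hx1, hx2, hx3]
    · obtain ⟨m, hm⟩ := IsAlgClosed.exists_pow_nat_eq (x 2) (n := 3) (by norm_num)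
      have hm0 : m ≠ 0 := by rintro rfl; apply hx2; rw [← hm]; simp
      refine ⟨x 3 / m ^ 2, m, ?_⟩
      rw [← hm] at h1 h3
      ext i; fin_cases i
      · simp
        field_simp
        linear_combination (-9) * δ * m ^ 3 * h1 - x 3 * h3
      · simp
        field_simp
        linear_combination -h3
      · simp
        field_simp
      · simp [hm]
  · rintro ⟨l, m, rfl⟩
    refine ⟨![-(l ^ 3) / (9 * δ), l ^ 2 * m / (3 * δ), m ^ 3, l * m ^ 2], ?_, ?_⟩
    · rw [hZ]
      refine ⟨?_, ?_, ?_⟩ <;> simp <;> field_simp <;> ring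
    · rw [ψa]
      ext i; fin_cases i <;> simp <;> field_simp

lemma L0_push {Z : Set (Fin 4 → ℂ)} {M N : Matrix (Fin 4) (Fin 4) ℂ} (h1 : M * N = 1)
    (L0 : ∀ a, LV Z a → a = 0) : ∀ a, LV (M.mulVec '' Z) a → a = 0 := by
  intro a ha
  have e := L0 _ ((LV_tr M a).1 ha)
  have : N.transpose.mulVec (M.transpose.mulVec a) = a := by
    rw [Matrix.mulVec_mulVec, ← Matrix.transpose_mul, h1, Matrix.transpose_one, Matrix.one_mulVec]
  rw [← this, e, Matrix.mulVec_zero]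

lemma inv_app {M N : Matrix (Fin 4) (Fin 4) ℂ} (h1 : M * N = 1) (a : Fin 4 → ℂ) :
    N.transpose.mulVec (M.transpose.mulVec a) = a := by
  rw [Matrix.mulVec_mulVec, ← Matrix.transpose_mul, h1, Matrix.transpose_one, Matrix.one_mulVec]

lemma QV_push {Z : Set (Fin 4 → ℂ)} {M N S : Matrix (Fin 4) (Fin 4) ℂ} (h1 : M * N = 1)
    (h2 : N * M = 1) (hS : QV Z S) : QV (M.mulVec '' Z) (N.transpose * S * N) := by
  rw [QV_tr h1]
  have : M.transpose * (N.transpose * S * N) * M = S := by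
    have h3 : M.transpose * N.transpose = 1 := by
      rw [← Matrix.transpose_mul, h2, Matrix.transpose_one]
    calc _ = (M.transpose * N.transpose) * S * (N * M) := by simp only [Matrix.mul_assoc]
      _ = S := by rw [h2, h3, Matrix.one_mul, Matrix.mul_one]
  rwa [this]

lemma push_app {M N : Matrix (Fin 4) (Fin 4) ℂ} (S : Matrix (Fin 4) (Fin 4) ℂ)
    (h2 : N * M = 1) (p : Fin 4 → ℂ) :
    (N.transpose * S * N).mulVec (M.mulVec p) = N.transpose.mulVec (S.mulVec p) := by
  rw [Matrix.mulVec_mulVec, Matrix.mul_assoc, h2, Matrix.mul_one, Matrix.mulVec_mulVec]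

lemma QV_add {Z : Set (Fin 4 → ℂ)} {S T : Matrix (Fin 4) (Fin 4) ℂ} (a b : ℂ)
    (hS : QV Z S) (hT : QV Z T) : QV Z (a • S + b • T) := by
  refine ⟨by simp [hS.1, hT.1], fun x hx => ?_⟩
  simp [Matrix.add_mulVec, Matrix.smul_mulVec, dotProduct_add, hS.2 x hx, hT.2 x hx]

lemma toGA {Z : Set (Fin 4 → ℂ)} {S : Matrix (Fin 4) (Fin 4) ℂ} (hS : QV Z S)
    (h : S.mulVec (Pi.single 0 1) = Pi.single 2 1) :
    G Z 0 0 1 0 (S 1 1 / 2) (S 1 2) (S 1 3) (S 2 2 / 2) (S 2 3) (S 3 3 / 2) := by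
  have h0 := congrFun h 0
  have h1 := congrFun h 1
  have h2 := congrFun h 2
  have h3 := congrFun h 3
  simp at h0 h1 h2 h3
  have e : ∀ i j, S i j = S j i := fun i j => congrFun (congrFun hS.1.symm i) j
  rw [sym_eq hS.1, QV_qm] at hS
  intro x hx
  have := hS x hx
  simp only [qf, e 0 1, e 0 2, e 0 3, h0, h1, h2, h3] at this ⊢
  linear_combination this / 2

lemma toGB {Z : Set (Fin 4 → ℂ)} {S : Matrix (Fin 4) (Fin 4) ℂ} (hS : QV Z S)
    (h : S.mulVec (Pi.single 0 1) = Pi.single 3 1) :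
    G Z 0 0 0 1 (S 1 1 / 2) (S 1 2) (S 1 3) (S 2 2 / 2) (S 2 3) (S 3 3 / 2) := by
  have h0 := congrFun h 0
  have h1 := congrFun h 1
  have h2 := congrFun h 2
  have h3 := congrFun h 3
  simp at h0 h1 h2 h3
  have e : ∀ i j, S i j = S j i := fun i j => congrFun (congrFun hS.1.symm i) j
  rw [sym_eq hS.1, QV_qm] at hS
  intro x hx
  have := hS x hx
  simp only [qf, e 0 1, e 0 2, e 0 3, h0, h1, h2, h3] at this ⊢
  linear_combination this / 2

lemma caseB {Z : Set (Fin 4 → ℂ)} (H : Hyp Z) (L0 : ∀ a, LV Z a → a = 0)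
    (he : (Pi.single 0 1 : Fin 4 → ℂ) ∈ Z) {A B : Matrix (Fin 4) (Fin 4) ℂ}
    (hA : QV Z A) (hB : QV Z B) (eA : A.mulVec (Pi.single 0 1) = Pi.single 2 1)
    (eB : B.mulVec (Pi.single 0 1) = Pi.single 3 1) : Concl Z := by
  have gA := toGA hA eA
  have gB := toGB hB eB
  obtain ⟨-, hα, -, hγ, -⟩ := stepB H L0 he gA gB
  generalize A 1 1 / 2 = α at *
  generalize A 1 2 = β at *
  generalize A 1 3 = γ at *
  generalize A 2 2 / 2 = a22 at *
  generalize A 2 3 = a23 at *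
  generalize A 3 3 / 2 = a33 at *
  obtain ⟨s, hs⟩ : ∃ s, s = -3 * β / 2 := ⟨_, rfl⟩
  obtain ⟨t2, ht2⟩ : ∃ t, t = 3 * a33 := ⟨_, rfl⟩
  obtain ⟨t1, ht1⟩ : ∃ t, t = (3 * a23 + 2 * s * t2) / 4 := ⟨_, rfl⟩
  obtain ⟨v, hv⟩ : ∃ t, t = t1 - s * t2 := ⟨_, rfl⟩
  obtain ⟨u, hu⟩ : ∃ t, t = a22 - t1 * s / 3 := ⟨_, rfl⟩
  obtain ⟨M, hMd⟩ : ∃ M : Matrix (Fin 4) (Fin 4) ℂ,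
    M = !![1, -s, u, v; 0, 1, t1, t2; 0, 0, 1, 0; 0, 0, s, 1] := ⟨_, rfl⟩
  have hM : Symp M := by
    intro a b
    simp [hMd, om, Matrix.mulVec, dotProduct, Fin.sum_univ_four]
    rw [hv]
    ring
  obtain ⟨N, h1, h2⟩ := hM.inv
  have hMe : M.mulVec (Pi.single 0 1) = Pi.single 0 1 := by
    ext i; fin_cases i <;> simp [hMd]
  apply Concl.tr hM
  have hT : QV Z ((1 : ℂ) • B + s • A) := QV_add _ _ hB hA
  have hT' := QV_push h1 h2 hT
  have eT : (N.transpose * ((1 : ℂ) • B + s • A) * N).mulVec (Pi.single 0 1) = Pi.single 3 1 := by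
    nth_rewrite 1 [← hMe]
    rw [push_app _ h2, ← inv_app h1 (Pi.single 3 1)]
    congr 1
    rw [Matrix.add_mulVec, Matrix.smul_mulVec, Matrix.smul_mulVec, eA, eB]
    ext i; fin_cases i <;> simp [hMd]
  refine caseC (H.tr hM) (L0_push h1 L0) ⟨_, he, hMe⟩ ?_ (toGB hT' eT)
  rintro _ ⟨x, hx, rfl⟩
  have := gA x hx
  simp only [qf, hα, hγ] at this
  simp [qf, hMd, Matrix.mulVec, dotProduct, Fin.sum_univ_four]
  subst hu hv ht1 ht2 hs
  linear_combination this

lemma om_comm0 {a b : Fin 4 → ℂ} (h : om a b = 0) : om b a = 0 := by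
  simp only [om] at h ⊢; linear_combination -h

lemma om_self (a : Fin 4 → ℂ) : om a a = 0 := by
  simp only [om]; ring

lemma exists_perp (a : Fin 4 → ℂ) : ∃ y, om a y = 0 ∧ ¬ ∃ c : ℂ, y = c • a := by
  by_cases h1 : a 1 = 0 ∧ a 3 = 0
  · refine ⟨Pi.single 1 1, by simp [om, h1.2], ?_⟩
    rintro ⟨c, hc⟩
    have := congrFun hc 1
    simp [h1.1] at this
  by_cases h0 : a 0 = 0 ∧ a 2 = 0
  · refine ⟨Pi.single 0 1, by simp [om, h0.2], ?_⟩
    rintro ⟨c, hc⟩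
    have := congrFun hc 0
    simp [h0.1] at this
  refine ⟨![a 0, 0, a 2, 0], by simp [om]; ring, ?_⟩
  rintro ⟨c, hc⟩
  have e0 := congrFun hc 0
  have e1 := congrFun hc 1
  have e2 := congrFun hc 2
  have e3 := congrFun hc 3
  simp at e0 e1 e2 e3
  have hc0 : c = 0 := by
    by_contra hne
    exact h1 ⟨e1.resolve_left hne, e3.resolve_left hne⟩
  simp [hc0] at e0 e2
  exact h0 ⟨e0, e2⟩

lemma core {Z : Set (Fin 4 → ℂ)} (H : Hyp Z) : Concl Z := by
  by_cases hL : ∃ a, a ≠ 0 ∧ LV Z a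
  · obtain ⟨a, ha0, ha⟩ := hL
    by_cases hb : ∃ b, LV Z b ∧ ¬ ∃ c : ℂ, b = c • a
    · obtain ⟨b, hb, hn⟩ := hb
      obtain ⟨M, hM, e2, e3⟩ := frame a b (minor_of ha0 hn) (H.ll a b ha hb)
      apply Concl.tr hM
      apply caseA1 (H.tr hM)
      · rw [LV_tr, e2]; exact ha
      · rw [LV_tr, e3]; exact hb
    · exfalso
      push Not at hb
      obtain ⟨y, hy, hn⟩ := exists_perp a
      obtain ⟨M, hM, e2, e3⟩ := frame a y (minor_of ha0 hn) hy
      obtain ⟨N, h1, h2⟩ := hM.inv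
      apply caseA2 (H.tr hM)
      · rw [LV_tr, e2]; exact ha
      · intro b hb'
        rw [LV_tr] at hb'
        obtain ⟨c, hc⟩ := hb _ hb'
        refine ⟨c, ?_⟩
        rw [← inv_app h1 b, hc, ← e2, Matrix.mulVec_smul, inv_app h1]
  · have L0 : ∀ a, LV Z a → a = 0 := by
      intro a ha
      by_contra h
      exact hL ⟨a, h, ha⟩
    obtain ⟨p, hp, hr⟩ := H.rank
    obtain ⟨S1, hS1, n1⟩ := (hr 0).resolve_left (by
      rintro ⟨a, ha, hn⟩
      exact hn ⟨0, by simp [L0 a ha]⟩)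
    obtain ⟨S2, hS2, n2⟩ := (hr (S1.mulVec p)).resolve_left (by
      rintro ⟨a, ha, hn⟩
      exact hn ⟨0, by simp [L0 a ha]⟩)
    have d1 : S1.mulVec p ≠ 0 := fun h => n1 ⟨0, by simp [h]⟩
    have q12 := H.qq S1 S2 hS1 hS2 p hp
    obtain ⟨y0, hy0⟩ : ∃ y : Fin 4 → ℂ, y = ![-p 2, -p 3, p 0, p 1] := ⟨_, rfl⟩
    have omy : ∀ m, om m y0 = m ⬝ᵥ p := by
      intro m
      simp [om, hy0, dotProduct, Fin.sum_univ_four]; ring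
    have y0ne : y0 ≠ 0 := by
      intro h
      apply d1
      have : p = 0 := by
        rw [hy0] at h
        have e0 := congrFun h 0
        have e1 := congrFun h 1
        have e2 := congrFun h 2
        have e3 := congrFun h 3
        simp at e0 e1 e2 e3
        ext i; fin_cases i <;> simp [e0, e1, e2, e3]
      simp [this]
    obtain ⟨α, β, hab⟩ : ∃ α β : ℂ, y0 = α • S1.mulVec p + β • S2.mulVec p := by
      obtain ⟨M, hM, e2, e3⟩ := frame _ _ (minor_of d1 n2) q12
      obtain ⟨N, h1, h2⟩ := hM.inv
      obtain ⟨c, hc⟩ : ∃ c, y0 = M.transpose.mulVec c := by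
        refine ⟨N.transpose.mulVec y0, ?_⟩
        rw [Matrix.mulVec_mulVec, ← Matrix.transpose_mul, h2, Matrix.transpose_one,
          Matrix.one_mulVec]
      have z1 : om (S1.mulVec p) y0 = 0 := by rw [omy, dotProduct_comm]; exact hS1.2 p hp
      have z2 : om (S2.mulVec p) y0 = 0 := by rw [omy, dotProduct_comm]; exact hS2.2 p hp
      rw [← e2, hc, hM] at z1
      rw [← e3, hc, hM] at z2
      simp [om] at z1 z2
      refine ⟨c 2, c 3, ?_⟩
      rw [hc, ← e2, ← e3, ← Matrix.mulVec_smul, ← Matrix.mulVec_smul, ← Matrix.mulVec_add]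
      congr 1
      ext i; fin_cases i <;> simp [z1, z2]
    have hA : QV Z (α • S1 + β • S2) := QV_add _ _ hS1 hS2
    have eA : (α • S1 + β • S2).mulVec p = y0 := by
      rw [hab, Matrix.add_mulVec, Matrix.smul_mulVec, Matrix.smul_mulVec]
    generalize α • S1 + β • S2 = A at hA eA
    obtain ⟨B, hB, nB⟩ : ∃ B, QV Z B ∧ ¬ ∃ c : ℂ, B.mulVec p = c • y0 := by
      by_cases hβ : β = 0
      · refine ⟨S2, hS2, ?_⟩
        rintro ⟨c, hc⟩
        apply n2
        refine ⟨c * α, ?_⟩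
        rw [hc, hab, hβ, mul_smul]; simp
      · refine ⟨S1, hS1, ?_⟩
        rintro ⟨c, hc⟩
        have hc0 : c ≠ 0 := by
          rintro rfl
          apply d1; simp [hc]
        apply n2
        refine ⟨(c * β)⁻¹ * (1 - c * α), ?_⟩
        have : (c * β) • S2.mulVec p = (1 - c * α) • S1.mulVec p := by
          rw [hab] at hc
          ext i
          have := congrFun hc i
          simp at this ⊢
          linear_combination -this
        rw [mul_smul, ← this, smul_smul, inv_mul_cancel₀ (mul_ne_zero hc0 hβ), one_smul]
    obtain ⟨M, hM, e2, e3⟩ := frame y0 (B.mulVec p) (minor_of y0ne nB) (by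
      rw [← eA]; exact H.qq _ _ hA hB p hp)
    obtain ⟨N, h1, h2⟩ := hM.inv
    have hMp : M.mulVec p = Pi.single 0 1 := by
      ext i
      have : (M.mulVec p) i = om (Pi.single i 1) (Pi.single 2 1) := by
        rw [← hM, e2, omy, ← dot_tr]; simp
      rw [this]
      fin_cases i <;> simp [om]
    apply Concl.tr hM
    refine caseB (H.tr hM) (L0_push h1 L0) ⟨p, hp, hMp⟩ (QV_push h1 h2 hA) (QV_push h1 h2 hB) ?_ ?_
    · rw [← hMp, push_app _ h2, eA, ← e2, inv_app h1]
    · rw [← hMp, push_app _ h2, ← e3, inv_app h1]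

noncomputable def lin (a : Fin 4 → ℂ) : MvPolynomial (Fin 4) ℂ := ∑ i, C (a i) * X i

noncomputable def quad (S : Matrix (Fin 4) (Fin 4) ℂ) : MvPolynomial (Fin 4) ℂ :=
  ∑ i, ∑ j, C (S i j) * (X i * X j)

lemma eval_lin (a x : Fin 4 → ℂ) : eval x (lin a) = a ⬝ᵥ x := by
  simp [lin, dotProduct]

lemma eval_quad (S : Matrix (Fin 4) (Fin 4) ℂ) (x : Fin 4 → ℂ) :
    eval x (quad S) = x ⬝ᵥ S.mulVec x := by
  simp [quad, dotProduct, Matrix.mulVec, Finset.mul_sum]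
  refine Finset.sum_congr rfl fun i _ => Finset.sum_congr rfl fun j _ => by ring

lemma pd_lin (a x : Fin 4 → ℂ) (k : Fin 4) : eval x (pderiv k (lin a)) = a k := by
  simp [lin, pderiv_X, Pi.single_apply, apply_ite (eval x)]

lemma pd_quad {S : Matrix (Fin 4) (Fin 4) ℂ} (hS : S.transpose = S) (x : Fin 4 → ℂ) (k : Fin 4) :
    eval x (pderiv k (quad S)) = 2 * S.mulVec x k := by
  have e : ∀ i j, S i j = S j i := fun i j => congrFun (congrFun hS.symm i) j
  have : ∀ i j, eval x (pderiv k (C (S i j) * (X i * X j))) =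
      (if i = k then S i j * x j else 0) + (if j = k then S j i * x i else 0) := by
    intro i j
    rw [e j i]
    simp only [pderiv_mul, pderiv_C, pderiv_X, Pi.single_apply]
    split_ifs <;> simp <;> ring
  simp only [quad, map_sum, this, Finset.sum_add_distrib]
  rw [Finset.sum_comm]
  simp [Matrix.mulVec, dotProduct]
  ring

lemma deg2 (f : MvPolynomial (Fin 4) ℂ) (hf : f.totalDegree ≤ 2) :
    ∃ (c : ℂ) (a : Fin 4 → ℂ) (S : Matrix (Fin 4) (Fin 4) ℂ), S.transpose = S ∧
      f = C c + lin a + quad S := by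
  suffices h : ∃ (c : ℂ) (a : Fin 4 → ℂ) (S : Matrix (Fin 4) (Fin 4) ℂ), S.transpose = S ∧
      ∀ x, eval x f = c + a ⬝ᵥ x + x ⬝ᵥ S.mulVec x by
    obtain ⟨c, a, S, hS, h⟩ := h
    refine ⟨c, a, S, hS, MvPolynomial.funext fun x => ?_⟩
    rw [h]; simp [eval_lin, eval_quad]
  rw [f.as_sum]
  have hd : ∀ m ∈ f.support, m.degree ≤ 2 := fun m hm => (le_totalDegree hm).trans hf
  refine Finset.sum_induction _ (fun f => ∃ (c : ℂ) (a : Fin 4 → ℂ)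
      (S : Matrix (Fin 4) (Fin 4) ℂ), S.transpose = S ∧
      ∀ x, eval x f = c + a ⬝ᵥ x + x ⬝ᵥ S.mulVec x) ?_ ?_ ?_
  · rintro f g ⟨c, a, S, hS, h⟩ ⟨c', a', S', hS', h'⟩
    refine ⟨c + c', a + a', S + S', by simp [hS, hS'], fun x => ?_⟩
    simp [h, h', Matrix.add_mulVec, add_dotProduct, dotProduct_add]
    ring
  · exact ⟨0, 0, 0, by simp, by simp⟩
  · intro m hm
    have hm2 := hd m hm
    generalize coeff m f = r
    have key : ∀ m : Fin 4 →₀ ℕ, m = 0 ∨ ∃ i m', m = Finsupp.single i 1 + m' := by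
      intro m
      by_cases h : m = 0
      · exact Or.inl h
      · right
        obtain ⟨i, hi⟩ := Finsupp.ne_iff.1 h
        refine ⟨i, m - Finsupp.single i 1, ?_⟩
        rw [add_tsub_cancel_of_le]
        simpa [Nat.one_le_iff_ne_zero] using hi
    rcases key m with rfl | ⟨i, m, rfl⟩
    · exact ⟨r, 0, 0, by simp, by simp⟩
    rcases key m with rfl | ⟨j, m, rfl⟩
    · refine ⟨0, Pi.single i r, 0, by simp, fun x => by simp [eval_monomial]⟩
    rcases key m with rfl | ⟨k, m, rfl⟩
    · refine ⟨0, 0, Matrix.single i j (r / 2) + Matrix.single j i (r / 2), ?_, fun x => ?_⟩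
      · simp [add_comm]
      · have e1 : x ⬝ᵥ (Matrix.single i j (r / 2)).mulVec x = r / 2 * (x i * x j) := by
          rw [← eval_quad]
          simp [quad, Matrix.single_apply, ite_and]
        have e2 : x ⬝ᵥ (Matrix.single j i (r / 2)).mulVec x = r / 2 * (x i * x j) := by
          rw [← eval_quad]
          simp [quad, Matrix.single_apply, ite_and, mul_comm (x j)]
        rw [Matrix.add_mulVec, dotProduct_add, e1, e2, add_zero, monomial_add_single, eval_mul,
          eval_monomial]
        simp
        ring
    · simp at hm2
      omega

lemma eval_smul_hom {f : MvPolynomial (Fin 4) ℂ} {d : ℕ} (hd : f.IsHomogeneous d)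
    (x : Fin 4 → ℂ) (t : ℂ) : eval (t • x) f = t ^ d * eval x f := by
  rw [eval_eq', eval_eq', Finset.mul_sum]
  refine Finset.sum_congr rfl fun m hm => ?_
  simp only [Pi.smul_apply, smul_eq_mul, mul_pow, Finset.prod_mul_distrib, Finset.prod_pow_eq_pow_sum]
  have : ∑ i, m i = d := by
    rw [← Finsupp.degree_eq_sum, Finsupp.degree_eq_weight_one]
    exact hd (mem_support_iff.1 hm)
  rw [this]
  ring

theorem toHyp (I : Ideal (MvPolynomial (Fin 4) ℂ))
    (hprime : I.IsPrime)
    (hhom : ∃ S : Set (MvPolynomial (Fin 4) ℂ),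
      (∀ f ∈ S, ∃ d : ℕ, f.IsHomogeneous d) ∧ I = Ideal.span S)
    (hgen : I = Ideal.span {f : MvPolynomial (Fin 4) ℂ | f ∈ I ∧ f.totalDegree ≤ 2})
    (hdim : ringKrullDim (MvPolynomial (Fin 4) ℂ ⧸ I) = 2)
    (hleg : ∀ x : Fin 4 → ℂ, (∀ f ∈ I, eval x f = 0) →
      ∀ f ∈ I, ∀ g ∈ I, eval x (poissonBracket4 f g) = 0) :
    Hyp {x : Fin 4 → ℂ | ∀ f ∈ I, eval x f = 0} := by
  obtain ⟨p, hp, hrk⟩ := rank_lemma I hprime hdim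
  obtain ⟨Z, hZ⟩ : ∃ Z, Z = {x : Fin 4 → ℂ | ∀ f ∈ I, eval x f = 0} := ⟨_, rfl⟩
  have mZ : ∀ x, x ∈ Z ↔ ∀ f ∈ I, eval x f = 0 := by intro x; rw [hZ]; rfl
  rw [← hZ]
  have hnull : ∀ f, (∀ x ∈ Z, eval x f = 0) → f ∈ I := fun f h =>
    null hprime fun x hx => h x ((mZ x).2 hx)
  have lI : ∀ a, LV Z a ↔ lin a ∈ I := fun a =>
    ⟨fun h => hnull _ fun x hx => by rw [eval_lin]; exact h x hx,
     fun h x hx => by rw [← eval_lin]; exact (mZ x).1 hx _ h⟩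
  have qI : ∀ S, QV Z S ↔ S.transpose = S ∧ quad S ∈ I := fun S =>
    and_congr_right fun _ => 
    ⟨fun h => hnull _ fun x hx => by rw [eval_quad]; exact h x hx,
     fun h x hx => by rw [← eval_quad]; exact (mZ x).1 hx _ h⟩
  have cone : ∀ x ∈ Z, ∀ t : ℂ, t • x ∈ Z := by
    intro x hx t
    rw [mZ] at hx ⊢
    obtain ⟨S, hS, rfl⟩ := hhom
    intro f hf
    induction hf using Submodule.span_induction with
    | mem f hf =>
      obtain ⟨d, hd⟩ := hS f hf
      have h0 := hx f (Ideal.subset_span hf)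
      rw [eval_smul_hom hd, h0, mul_zero]
    | zero => simp
    | add f g _ _ h1 h2 => simp [h1, h2]
    | smul g f _ h => simp [h]
  have dec : ∀ f ∈ I, f.totalDegree ≤ 2 → ∃ a S, LV Z a ∧ QV Z S ∧ f = lin a + quad S := by
    intro f hf hd
    obtain ⟨c, a, S, hS, e⟩ := deg2 f hd
    have ev : ∀ x ∈ Z, ∀ t : ℂ, c + t * (a ⬝ᵥ x) + t ^ 2 * (x ⬝ᵥ S.mulVec x) = 0 := by
      intro x hx t
      have := (mZ _).1 (cone x hx t) f hf
      rw [e] at this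
      simp [eval_lin, eval_quad, Matrix.mulVec_smul] at this
      linear_combination this
    have hc : c = 0 := by simpa using ev p ((mZ p).2 hp) 0
    refine ⟨a, S, fun x hx => ?_, ⟨hS, fun x hx => ?_⟩, by rw [e, hc]; simp⟩
    · linear_combination (ev x hx 1 - ev x hx (-1)) / 2
    · linear_combination (ev x hx 1 + ev x hx (-1)) / 2 - hc
  have leg : ∀ x ∈ Z, ∀ f ∈ I, ∀ g ∈ I, eval x (poissonBracket4 f g) = 0 := fun x hx =>
    hleg x ((mZ x).1 hx)
  refine ⟨?_, ?_, ?_, ?_, ?_, ?_, p, (mZ p).2 hp, ?_⟩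
  · intro a b h
    rw [lI, lI]
    apply hprime.mem_or_mem
    apply hnull
    simpa [eval_lin] using h
  · intro a S hS h
    have : lin a ∈ I ∨ quad S ∈ I := by
      apply hprime.mem_or_mem
      apply hnull
      simpa [eval_lin, eval_quad] using h
    rw [lI, qI]
    exact this.imp id fun h => ⟨hS, h⟩
  · intro a b ha hb
    have := leg p ((mZ p).2 hp) _ ((lI a).1 ha) _ ((lI b).1 hb)
    simpa [poissonBracket4, pd_lin, om] using this
  · intro a S ha hS x hx
    have := leg x hx _ ((lI a).1 ha) _ ((qI S).1 hS).2
    simp only [poissonBracket4, map_add, map_sub, map_mul, pd_lin, pd_quad hS.1] at this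
    simp only [om]
    linear_combination this / 2
  · intro S T hS hT x hx
    have := leg x hx _ ((qI S).1 hS).2 _ ((qI T).1 hT).2
    simp only [poissonBracket4, map_add, map_sub, map_mul, pd_quad hS.1, pd_quad hT.1] at this
    simp only [om]
    linear_combination this / 4
  · intro x h1 h2
    rw [mZ]
    intro f hf
    rw [hgen] at hf
    induction hf using Submodule.span_induction with
    | mem f hf =>
      obtain ⟨a, S, ha, hS, rfl⟩ := dec f hf.1 hf.2
      simp [eval_lin, eval_quad, h1 a ha, h2 S hS]
    | zero => simp
    | add f g _ _ h1 h2 => simp [h1, h2]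
    | smul g f _ h => simp [h]
  · intro w
    by_contra hcon
    push Not at hcon
    obtain ⟨c1, c2⟩ := hcon
    obtain ⟨f, hf, hn⟩ := hrk w
    apply hn
    clear hn
    rw [hgen] at hf
    induction hf using Submodule.span_induction with
    | mem f hf =>
      obtain ⟨a, S, ha, hS, rfl⟩ := dec f hf.1 hf.2
      obtain ⟨c, hc⟩ := c1 a ha
      obtain ⟨d, hd⟩ := c2 S hS
      refine ⟨c + 2 * d, fun i => ?_⟩
      simp only [map_add, pd_lin, pd_quad hS.1, hd]
      rw [hc]
      simp; ring
    | zero => exact ⟨0, by simp⟩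
    | add f g _ _ h1 h2 =>
      obtain ⟨c, hc⟩ := h1
      obtain ⟨d, hd⟩ := h2
      refine ⟨c + d, fun i => ?_⟩
      simp [hc, hd]; ring
    | smul g f hf h =>
      obtain ⟨c, hc⟩ := h
      refine ⟨eval p g * c, fun i => ?_⟩
      have := hp f (hgen ▸ hf)
      simp [hc, this]; ring

/-- Every irreducible legendrian curve in `ℙ³` whose ideal is generated in degrees `≤ 2`
is, up to a linear change of coordinates, a line or the twisted cubic. -/
theorem legendrian_curve_generated_by_quadrics (I : Ideal (MvPolynomial (Fin 4) ℂ))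
    (hprime : I.IsPrime)
    (hhom : ∃ S : Set (MvPolynomial (Fin 4) ℂ),
      (∀ f ∈ S, ∃ d : ℕ, f.IsHomogeneous d) ∧ I = Ideal.span S)
    (hgen : I = Ideal.span {f : MvPolynomial (Fin 4) ℂ | f ∈ I ∧ f.totalDegree ≤ 2})
    (hdim : ringKrullDim (MvPolynomial (Fin 4) ℂ ⧸ I) = 2)
    (hleg : ∀ x : Fin 4 → ℂ, (∀ f ∈ I, eval x f = 0) →
      ∀ f ∈ I, ∀ g ∈ I, eval x (poissonBracket4 f g) = 0) :
    ∃ ψ : (Fin 4 → ℂ) ≃ₗ[ℂ] (Fin 4 → ℂ),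
      (∃ W : Submodule ℂ (Fin 4 → ℂ), Module.finrank ℂ W = 2 ∧
        ψ '' {x : Fin 4 → ℂ | ∀ f ∈ I, eval x f = 0} = (W : Set (Fin 4 → ℂ))) ∨
      ψ '' {x : Fin 4 → ℂ | ∀ f ∈ I, eval x f = 0} =
        {v : Fin 4 → ℂ | ∃ l m : ℂ, v = ![l ^ 3, l ^ 2 * m, l * m ^ 2, m ^ 3]} := by
  exact core (toHyp I hprime hhom hgen hdim hleg)
end

section
/- Let L be a finite-dimensional semisimple complex Lie algebra with Cartan subalgebra H, and let V be a finite-dimensional L-module. Let α: H → ℂ be a root of L (i.e. α ≠ 0 and the root space L_α = {g ∈ L : [h,g] = α(h)·g for all h ∈ H} is nonzero) and λ: H → ℂ a weight of V such that λ + α is also a weight of V (i.e. both weight spaces V_λ and V_{λ+α} are nonzero). Then for every nonzero g ∈ L_α, the linear map V_λ → V_{λ+α}, v ↦ g·v, is not identically zero. -/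
open LieAlgebra LieModule LieAlgebra.IsKilling in
theorem aux_sl2 {L V : Type*} [LieRing L] [LieAlgebra ℂ L] 
    [AddCommGroup V] [Module ℂ V] [LieRingModule L V] [LieModule ℂ L V]
    [FiniteDimensional ℂ V] {h e f : L} (t : IsSl2Triple h e f) (n : ℕ) (w : V) (hw : w ≠ 0)
    (hhw : ⁅h, w⁆ = ((n : ℂ) + 2) • w) (hef : ⁅e, ⁅f, w⁆⁆ = 0) : False := by
  have key : ∀ k : ℕ, ⁅f, ((toEnd ℂ L V e) ^ (k + 1)) w⁆
      = (-((k + 1 : ℂ) * (n + 2 + k))) • ((toEnd ℂ L V e) ^ k) w := by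
    intro k
    have h1 : ∀ x : V, ⁅f, ⁅e, x⁆⁆ = ⁅e, ⁅f, x⁆⁆ - ⁅h, x⁆ := by
      intro x
      rw [← t.lie_e_f, lie_lie]; abel
    have h2 := t.lie_h_pow_toEnd_e (R := ℂ) hhw
    induction k with
    | zero => simp [h1, hef, hhw, ← neg_smul]
    | succ k ih =>
      rw [pow_succ', Module.End.mul_apply, toEnd_apply_apply, h1, ih, h2, lie_smul,
        IsSl2Triple.lie_e_pow_toEnd_e, ← sub_smul]
      congr 1
      push_cast
      ring
  have contra : ∀ k : ℕ, ((toEnd ℂ L V e) ^ k) w ≠ 0 := by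
    intro k
    induction k with
    | zero => simpa using hw
    | succ k ih =>
      intro h0
      have := key k
      rw [h0, lie_zero, eq_comm, smul_eq_zero] at this
      refine this.elim (fun h => ?_) ih
      have h3 : ((k + 1) * (n + 2 + k) : ℕ) = (0 : ℂ) := by
        push_cast; exact neg_eq_zero.mp h
      rw [Nat.cast_eq_zero] at h3
      simp at h3
  let evals (k : ℕ) : ℂ := ((n : ℂ) + 2) + 2 * (k : ℂ)
  have h_inj : Function.Injective evals := fun a b hab ↦ by
    simpa [evals] using hab
  have aux (μ : Set.range evals) : (toEnd ℂ L V h).HasEigenvector μ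
      (((toEnd ℂ L V e) ^ μ.property.choose) w) := by
    set m := μ.property.choose
    refine ⟨?_, contra m⟩
    rw [Module.End.mem_eigenspace_iff, toEnd_apply_apply, ← μ.property.choose_spec]
    exact t.lie_h_pow_toEnd_e hhw m
  have _i := ((toEnd ℂ L V h).eigenvectors_linearIndependent (Set.range evals) _ aux).finite
  exact (Set.infinite_range_of_injective h_inj) (Set.toFinite _)

open LieAlgebra LieModule LieAlgebra.IsKilling in

/-- Let `L` be a finite-dimensional semisimple complex Lie algebra with Cartan subalgebra
`H`, `V` a finite-dimensional `L`-module, `α` a root of `L` and `lam` a weight of `V` such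
that `lam + α` is also a weight of `V`.  Then for every nonzero `g` in the root space `L_α`,
the map `V_lam → V_{lam+α}`, `v ↦ g·v`, is not identically zero. -/
theorem rootSpace_map_on_weightSpace_ne_zero (L : Type*) [LieRing L] [LieAlgebra ℂ L]
    [FiniteDimensional ℂ L] [LieAlgebra.IsSemisimple ℂ L]
    (H : LieSubalgebra ℂ L) [H.IsCartanSubalgebra]
    (V : Type*) [AddCommGroup V] [Module ℂ V] [LieRingModule L V] [LieModule ℂ L V]
    [FiniteDimensional ℂ V]
    (α : H → ℂ) (hα : α ≠ 0)
    (hroot : ∃ g : L, g ≠ 0 ∧ ∀ h : H, ⁅(h : L), g⁆ = α h • g)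
    (lam : H → ℂ)
    (hlam : ∃ v : V, v ≠ 0 ∧ ∀ h : H, ⁅(h : L), v⁆ = lam h • v)
    (hlamα : ∃ w : V, w ≠ 0 ∧ ∀ h : H, ⁅(h : L), w⁆ = (lam h + α h) • w)
    (g : L) (hg : g ≠ 0) (hgα : ∀ h : H, ⁅(h : L), g⁆ = α h • g) :
    ∃ v : V, (∀ h : H, ⁅(h : L), v⁆ = lam h • v) ∧ ⁅g, v⁆ ≠ 0 := by
  have : LieAlgebra.IsKilling ℂ L := inferInstance
  have mem : ∀ x : L, (∀ h : H, ⁅(h : L), x⁆ = α h • x) → x ∈ rootSpace H α := fun x hx =>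
    (mem_genWeightSpace L α x).mpr fun y ↦ ⟨1, by
      simp only [pow_one, LinearMap.sub_apply, toEnd_apply_apply, LinearMap.smul_apply,
        Module.End.one_apply]
      exact sub_eq_zero.mpr (hx y)⟩
  have hgm := mem g hgα
  let A : Weight ℂ H L := ⟨α, fun hb => hg (by
    have h5 : g ∈ genWeightSpace L α := hgm
    rw [hb] at h5; simpa using h5)⟩
  have hA : A.IsNonZero := fun h0 => hα h0
  obtain ⟨h, e, f, t, he, hf⟩ := exists_isSl2Triple_of_weight_isNonZero hA
  have hh := t.h_eq_coroot hA he hf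
  have hα2 : α (coroot A) = 2 := root_apply_coroot hA
  have hfα : ∀ y : H, ⁅(y : L), f⁆ = (-α y) • f := fun y => lie_eq_smul_of_mem_rootSpace hf y
  obtain ⟨c, hc⟩ : ∃ c : ℂ, c • g = e := by
    have h1 := finrank_rootSpace_eq_one A hA
    have := (finrank_eq_one_iff_of_nonzero' (⟨g, hgm⟩ : rootSpace H A)
      (fun h => hg (congrArg Subtype.val h))).mp h1 ⟨e, he⟩
    obtain ⟨c, hc⟩ := this
    exact ⟨c, congrArg Subtype.val hc⟩
  by_contra! hcon
  have hcon' : ∀ v : V, (∀ h : H, ⁅(h : L), v⁆ = lam h • v) → ⁅e, v⁆ = 0 := fun v hv => by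
    rw [← hc, smul_lie, hcon v hv, smul_zero]
  obtain ⟨v, hv0, hv⟩ := hlam
  obtain ⟨w, hw0, hw⟩ := hlamα
  have P : t.HasPrimitiveVectorWith v (lam (coroot A)) :=
    ⟨hv0, by rw [hh]; exact hv _, hcon' v hv⟩
  obtain ⟨n, hn⟩ := P.exists_nat
  refine aux_sl2 t n w hw0 ?_ (hcon' _ fun y => ?_)
  · rw [hh, hw, hn, hα2]
  · rw [leibniz_lie, hfα, hw, smul_lie, lie_smul, ← add_smul]
    congr 1
    ring
end
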